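/- arXiv:2404.03604 — 5 statements merged into one kernel-verified Lean document; each statement's English description precedes it below -/
import Mathlib

section
/- (Separability.) Let x ∈ ℝ_{≥0}^n, T ≥ 0, let i ∈ {1,…,n}, δ ≥ 0, and let e_i denote the i-th unit vector. Set α = Z_i^FP(x + δe_i, T) − Z_i^FP(x, T). Then 0 ≤ α ≤ T, and: (i) Z_j^FP(x + δe_i, T) = Z_j^FP(x, T − α) for every j ≠ i (including the outside option j = 0), while Z_i^FP(x + δe_i, T) = α + Z_i^FP(x, T − α); (ii) f^FP(x + δe_i, T) = f^FP(x, T − α) + α·r_i. -/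
open Finset

/-- The no-purchase fluid quantity `Z₀^FP(x,T)`: the unique `z ≥ 0` with
`z + ∑ i min(vᵢ z, xᵢ) = T` (we take the infimum of the solution set, which is a singleton). -/
noncomputable def Z0FP {n : ℕ} (v x : Fin n → ℝ) (T : ℝ) : ℝ :=
  sInf {z : ℝ | 0 ≤ z ∧ z + ∑ i, min (v i * z) (x i) = T}

/-- Fluid consumption of product `i`: `Z_i^FP(x,T) = min(vᵢ Z₀^FP(x,T), xᵢ)`. -/
noncomputable def ZFP {n : ℕ} (v x : Fin n → ℝ) (i : Fin n) (T : ℝ) : ℝ :=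
  min (v i * Z0FP v x T) (x i)

/-- Fluid revenue `f^FP(x,T) = ∑ i rᵢ Z_i^FP(x,T)`. -/
noncomputable def fFP {n : ℕ} (r v x : Fin n → ℝ) (T : ℝ) : ℝ :=
  ∑ i, r i * ZFP v x i T

theorem strictMono_fluid {n : ℕ} {v : Fin n → ℝ} (hv : ∀ i, 0 < v i) (x : Fin n → ℝ) :
    StrictMono fun z : ℝ => z + ∑ i, min (v i * z) (x i) := by
  intro a b hab
  have h : ∑ i, min (v i * a) (x i) ≤ ∑ i, min (v i * b) (x i) :=
    sum_le_sum fun i _ => min_le_min_right _ (mul_le_mul_of_nonneg_left hab.le (hv i).le)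
  exact add_lt_add_of_lt_of_le hab h

theorem Z0FP_eq {n : ℕ} {v : Fin n → ℝ} (hv : ∀ i, 0 < v i) {x : Fin n → ℝ} {T z : ℝ}
    (hz : 0 ≤ z) (h : z + ∑ i, min (v i * z) (x i) = T) : Z0FP v x T = z := by
  have hs : {w : ℝ | 0 ≤ w ∧ w + ∑ i, min (v i * w) (x i) = T} = {z} := by
    ext w
    constructor
    · rintro ⟨-, hw⟩
      exact (strictMono_fluid hv x).injective (hw.trans h.symm)
    · rintro rfl
      exact ⟨hz, h⟩
  rw [Z0FP, hs, csInf_singleton]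

theorem Z0FP_spec {n : ℕ} {v : Fin n → ℝ} (hv : ∀ i, 0 < v i) {x : Fin n → ℝ}
    (hx : ∀ i, 0 ≤ x i) {T : ℝ} (hT : 0 ≤ T) :
    0 ≤ Z0FP v x T ∧ Z0FP v x T + ∑ i, min (v i * Z0FP v x T) (x i) = T := by
  have hc : Continuous fun z : ℝ => z + ∑ i, min (v i * z) (x i) := by fun_prop
  have h0 : (0 : ℝ) + ∑ i, min (v i * 0) (x i) = 0 := by
    simp [hx]
  have h1 : T ≤ T + ∑ i, min (v i * T) (x i) :=
    le_add_of_nonneg_right (sum_nonneg fun i _ => le_min (mul_nonneg (hv i).le hT) (hx i))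
  obtain ⟨z, hz, h⟩ := intermediate_value_Icc hT hc.continuousOn ⟨h0.le.trans hT, h1⟩
  rw [Z0FP_eq hv hz.1 h]
  exact ⟨hz.1, h⟩

theorem stmt5 {n : ℕ} (hn : 1 ≤ n) (r v : Fin n → ℝ)
    (hr : ∀ i j : Fin n, i ≤ j → r j ≤ r i) (hr0 : ∀ i, 0 ≤ r i)
    (hv : ∀ i, 0 < v i)
    (x : Fin n → ℝ) (hx : ∀ k, 0 ≤ x k) (T : ℝ) (hT : 0 ≤ T)
    (i : Fin n) (δ : ℝ) (hδ : 0 ≤ δ)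
    (x' : Fin n → ℝ) (hx' : x' = fun k => x k + if k = i then δ else 0)
    (α : ℝ) (hα : α = ZFP v x' i T - ZFP v x i T) :
    0 ≤ α ∧ α ≤ T ∧
    (∀ j : Fin n, j ≠ i → ZFP v x' j T = ZFP v x j (T - α)) ∧
    Z0FP v x' T = Z0FP v x (T - α) ∧
    ZFP v x' i T = α + ZFP v x i (T - α) ∧
    fFP r v x' T = fFP r v x (T - α) + α * r i := by
  obtain ⟨hz0, hz⟩ := Z0FP_spec hv hx hT
  have hx'0 : ∀ k, 0 ≤ x' k := by
    intro k
    rw [hx']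
    have := hx k
    dsimp only
    split_ifs <;> linarith
  obtain ⟨hw0, hw⟩ := Z0FP_spec hv hx'0 hT
  have hi : x' i = x i + δ := by simp [hx']
  have hne : ∀ k, k ≠ i → x' k = x k := fun k hk => by simp [hx', hk]
  have hsum : ∀ w : ℝ, ∑ k, min (v k * w) (x' k) =
      ∑ k, min (v k * w) (x k) + (min (v i * w) (x' i) - min (v i * w) (x i)) := by
    intro w
    rw [← sub_eq_iff_eq_add', ← sum_sub_distrib]
    refine sum_eq_single i (fun k _ hk => ?_) (fun h => absurd (mem_univ i) h)
    rw [hne k hk, sub_self]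
  unfold ZFP at hα
  set w := Z0FP v x' T
  set z := Z0FP v x T
  -- The consumption of product `i` out of its original stock is the same in both processes.
  have hkey : min (v i * w) (x i) = min (v i * z) (x i) := by
    rcases le_total (v i * z) (x i) with h | h
    · have hwz : w = z := Z0FP_eq hv hz0 (by
        rw [hsum, hi, min_eq_left h, min_eq_left (by linarith), sub_self, add_zero, hz])
      rw [hwz]
    · rcases le_total (x i) (v i * w) with h' | h'
      · rw [min_eq_right h, min_eq_right h']
      · have hzw : z = w := Z0FP_eq hv hw0 (by
          rw [hsum, hi, min_eq_left h', min_eq_left (by linarith), sub_self, add_zero] at hw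
          exact hw)
        rw [hzw]
  have hred : w + ∑ k, min (v k * w) (x k) = T - α := by
    have := hsum w
    linarith
  have hZ0 : Z0FP v x (T - α) = w := Z0FP_eq hv hw0 hred
  have hα0 : 0 ≤ α := by
    have : min (v i * w) (x i) ≤ min (v i * w) (x' i) := min_le_min_left _ (by linarith)
    linarith
  have hαT : α ≤ T := by
    have : 0 ≤ ∑ k, min (v k * w) (x k) :=
      sum_nonneg fun k _ => le_min (mul_nonneg (hv k).le hw0) (hx k)
    linarith
  have hj : ∀ j : Fin n, j ≠ i → ZFP v x' j T = ZFP v x j (T - α) := by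
    intro j hji
    rw [ZFP, ZFP, hZ0, hne j hji]
  have hZi : ZFP v x' i T = α + ZFP v x i (T - α) := by
    rw [ZFP, ZFP, hZ0, hkey, hα, sub_add_cancel]
  refine ⟨hα0, hαT, hj, hZ0.symm, hZi, ?_⟩
  rw [fFP, fFP, ← sub_eq_iff_eq_add', ← sum_sub_distrib,
    sum_eq_single i (fun k _ hk => by rw [hj k hk, sub_self]) (fun h => absurd (mem_univ i) h), hZi]
  ring
end

section
/- Let x ∈ ℤ_{≥0}^n, let i ∈ {1,…,n}, let T ∈ ℕ, and let p = φ(i, N(x)) = v_i/(1 + Σ_{k∈N(x)} v_k) be product i's purchase probability when all products of N(x) are offered. Then the expected consumption in the stochastic consumption process satisfies Z_i(x,T) ≥ E[min(Bin(T,p), x_i)]. -/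
open Finset

/-- Truncated binomial expectation `E[min(Bin(T,p), c)]`:
the expected sales of a product with `c` units in stock when each of `T` customers
independently buys one unit with probability `p` while stock remains. -/
noncomputable def binExpMin (T : ℕ) (p : ℝ) (c : ℝ) : ℝ :=
  ∑ k ∈ Finset.range (T + 1),
    min (k : ℝ) c * ((T.choose k : ℝ) * p ^ k * (1 - p) ^ (T - k))

/-- Expected consumption `Z_i(x,T)` of product `i` in the stochastic consumption
process without personalization under MNL, defined recursively over the number
of customers `T`.  `N(x) = {k : x_k ≥ 1}` is the set of available products and
`φ(j,S) = v_j / (1 + ∑_{k∈S} v_k)` (outside option weight `1`). -/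
noncomputable def Zstoch {n : ℕ} (v : Fin n → ℝ) (i : Fin n) : ℕ → (Fin n → ℕ) → ℝ
  | 0, _ => 0
  | T + 1, x =>
    (∑ j ∈ Finset.univ.filter (fun k => 1 ≤ x k),
      v j / (1 + ∑ k ∈ Finset.univ.filter (fun k => 1 ≤ x k), v k) *
        ((if j = i then 1 else 0) +
          Zstoch v i T (fun k => if k = j then x k - 1 else x k))) +
    (1 / (1 + ∑ k ∈ Finset.univ.filter (fun k => 1 ≤ x k), v k)) * Zstoch v i T x

/-- The binomial weights sum to one. -/
lemma sum_binomial_weights (T : ℕ) (q : ℝ) :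
    ∑ k ∈ Finset.range (T + 1), (T.choose k : ℝ) * q ^ k * (1 - q) ^ (T - k) = 1 := by
  have h := add_pow q (1 - q) T
  rw [add_sub_cancel, one_pow] at h
  exact (Finset.sum_congr rfl fun k _ => by ring).trans h.symm

lemma binExpMin_zero_right (T : ℕ) (q : ℝ) : binExpMin T q 0 = 0 :=
  Finset.sum_eq_zero fun k _ => by rw [min_eq_right (Nat.cast_nonneg k), zero_mul]

lemma binExpMin_zero_left (q : ℝ) {c : ℝ} (hc : 0 ≤ c) : binExpMin 0 q c = 0 := by
  simp [binExpMin, hc]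

/-- Conditioning on the first of `T + 1` trials. -/
lemma binExpMin_succ (T : ℕ) (q c : ℝ) :
    binExpMin (T + 1) q (c + 1) =
      q * (1 + binExpMin T q c) + (1 - q) * binExpMin T q (c + 1) := by
  have h := Finset.sum_choose_succ_mul
    (fun a b : ℕ => min (a : ℝ) (c + 1) * (q ^ a * (1 - q) ^ b)) T
  have hL : binExpMin (T + 1) q (c + 1) = ∑ k ∈ Finset.range (T + 2),
      ((T + 1).choose k : ℝ) * (min (k : ℝ) (c + 1) * (q ^ k * (1 - q) ^ (T + 1 - k))) :=
    Finset.sum_congr rfl fun k _ => by ring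
  rw [hL, h]
  have hw : q * (1 + binExpMin T q c) = q * (∑ k ∈ Finset.range (T + 1),
      (T.choose k : ℝ) * q ^ k * (1 - q) ^ (T - k) + binExpMin T q c) := by
    rw [sum_binomial_weights]
  rw [hw]
  simp only [binExpMin, ← Finset.sum_add_distrib, Finset.mul_sum]
  refine Finset.sum_congr rfl fun k hk => ?_
  have hk' : k ≤ T := Nat.lt_succ_iff.mp (Finset.mem_range.mp hk)
  rw [Nat.sub_add_comm hk', Nat.cast_succ, min_add_add_right]
  ring

/-- One extra unit of stock raises expected sales by at most one. -/
lemma binExpMin_add_one_le (T : ℕ) {q : ℝ} (h0 : 0 ≤ q) (h1 : q ≤ 1) (c : ℝ) :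
    binExpMin T q (c + 1) ≤ 1 + binExpMin T q c := by
  refine le_of_le_of_eq ?_ (congrArg (· + binExpMin T q c) (sum_binomial_weights T q))
  simp only [binExpMin, ← Finset.sum_add_distrib]
  refine Finset.sum_le_sum fun k _ => ?_
  have hw : 0 ≤ (T.choose k : ℝ) * q ^ k * (1 - q) ^ (T - k) := by
    have := sub_nonneg.mpr h1
    positivity
  have hm : min (k : ℝ) (c + 1) ≤ 1 + min (k : ℝ) c := by
    rw [add_comm 1, ← min_add_add_right]
    exact min_le_min_right _ (by linarith)
  linarith [mul_le_mul_of_nonneg_right hm hw]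

lemma Zstoch_nonneg {n : ℕ} {v : Fin n → ℝ} (hv : ∀ i, 0 < v i) (i : Fin n) (T : ℕ)
    (x : Fin n → ℕ) : 0 ≤ Zstoch v i T x := by
  induction T generalizing x with
  | zero => exact le_rfl
  | succ T ih =>
    have hD : 0 ≤ ∑ k ∈ Finset.univ.filter (fun k => 1 ≤ x k), v k :=
      Finset.sum_nonneg fun k _ => (hv k).le
    rw [Zstoch]
    refine add_nonneg (Finset.sum_nonneg fun j _ => ?_) (mul_nonneg (by positivity) (ih x))
    have := (hv j).le
    exact mul_nonneg (by positivity) (add_nonneg (by split_ifs <;> norm_num) (ih _))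

/-- The purchase probability of a product bounds from below any later one while it is in stock,
so a fixed lower bound `q` on it survives the induction on the number of customers. -/
lemma binExpMin_le_Zstoch {n : ℕ} {v : Fin n → ℝ} (hv : ∀ i, 0 < v i) (i : Fin n) {q : ℝ}
    (hq : 0 ≤ q) (T : ℕ) (x : Fin n → ℕ)
    (hqx : q ≤ v i / (1 + ∑ k ∈ Finset.univ.filter (fun k => 1 ≤ x k), v k)) :
    binExpMin T q (x i : ℝ) ≤ Zstoch v i T x := by
  induction T generalizing x with
  | zero => rw [binExpMin_zero_left q (Nat.cast_nonneg _), Zstoch]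
  | succ T ih =>
    rcases Nat.eq_zero_or_pos (x i) with hx | hx
    · rw [hx, Nat.cast_zero, binExpMin_zero_right]
      exact Zstoch_nonneg hv i _ x
    obtain ⟨c, hc⟩ := Nat.exists_eq_add_of_le' hx
    have hstep (j : Fin n) : q ≤ v i / (1 + ∑ k ∈ Finset.univ.filter
        (fun k => 1 ≤ if k = j then x k - 1 else x k), v k) := by
      have h0 : 0 ≤ ∑ k ∈ Finset.univ.filter
          (fun k => 1 ≤ if k = j then x k - 1 else x k), v k :=
        Finset.sum_nonneg fun k _ => (hv k).le
      refine hqx.trans (div_le_div_of_nonneg_left (hv i).le (by linarith) ?_)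
      gcongr 1 + ?_
      refine Finset.sum_le_sum_of_subset_of_nonneg (fun k => ?_) fun k _ _ => (hv k).le
      simp only [Finset.mem_filter, Finset.mem_univ, true_and]
      split_ifs <;> omega
    have hmem : i ∈ Finset.univ.filter (fun k => 1 ≤ x k) :=
      Finset.mem_filter.mpr ⟨Finset.mem_univ i, hx⟩
    have hiD : v i ≤ ∑ k ∈ Finset.univ.filter (fun k => 1 ≤ x k), v k :=
      Finset.single_le_sum (f := v) (fun k _ => (hv k).le) hmem
    have hout := ih x hqx
    rw [Zstoch]
    set S := Finset.univ.filter (fun k => 1 ≤ x k)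
    set D := 1 + ∑ k ∈ S, v k with hD
    have hvi := hv i
    have hDpos : 0 < D := by linarith
    have hp1 : v i / D ≤ 1 := (div_le_one hDpos).mpr (by linarith)
    have hcx : (x i : ℝ) = c + 1 := by rw [hc]; push_cast; rfl
    rw [hcx] at hout ⊢
    set A := binExpMin T q c
    set B := binExpMin T q (c + 1)
    have hterm : ∀ j ∈ S, v j / D * (if j = i then 1 + A else B) ≤
        v j / D * ((if j = i then 1 else 0) +
          Zstoch v i T (fun k => if k = j then x k - 1 else x k)) := by
      intro j _
      refine mul_le_mul_of_nonneg_left ?_ (div_nonneg (hv j).le hDpos.le)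
      have hj := ih _ (hstep j)
      by_cases hji : j = i
      · subst hji
        simpa [hc, A] using hj
      · simpa [hji, Ne.symm hji, hcx, B] using hj
    have hsum : ∑ j ∈ S, v j / D * (if j = i then 1 + A else B) + 1 / D * B =
        v i / D * (1 + A) + (1 - v i / D) * B := by
      have hsplit (j : Fin n) : v j / D * (if j = i then 1 + A else B) =
          v j / D * B + if j = i then v j / D * (1 + A - B) else 0 := by
        split_ifs <;> ring
      have htot : (∑ j ∈ S, v j) / D + 1 / D = 1 := by
        rw [← add_div, add_comm, ← hD, div_self hDpos.ne']
      rw [Finset.sum_congr rfl fun j _ => hsplit j, Finset.sum_add_distrib, ← Finset.sum_mul,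
        ← Finset.sum_div, Finset.sum_ite_eq' S i, if_pos hmem]
      linear_combination B * htot
    have hAB : B ≤ 1 + A := binExpMin_add_one_le T hq (hqx.trans hp1) c
    calc binExpMin (T + 1) q (c + 1) = q * (1 + A) + (1 - q) * B := binExpMin_succ T q c
      _ ≤ v i / D * (1 + A) + (1 - v i / D) * B := by
        linarith [mul_nonneg (sub_nonneg.mpr hqx) (sub_nonneg.mpr hAB)]
      _ = _ := hsum.symm
      _ ≤ _ := add_le_add (Finset.sum_le_sum hterm)
        (mul_le_mul_of_nonneg_left hout (by positivity))

theorem stmt11 {n : ℕ} (hn : 1 ≤ n) (r v : Fin n → ℝ)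
    (hr : ∀ i j : Fin n, i ≤ j → r j ≤ r i) (hr0 : ∀ i, 0 ≤ r i)
    (hv : ∀ i, 0 < v i)
    (x : Fin n → ℕ) (i : Fin n) (T : ℕ)
    (p : ℝ)
    (hp : p = v i / (1 + ∑ k ∈ Finset.univ.filter (fun k => 1 ≤ x k), v k)) :
    binExpMin T p (x i : ℝ) ≤ Zstoch v i T x := by
  have hD : 0 ≤ ∑ k ∈ Finset.univ.filter (fun k => 1 ≤ x k), v k :=
    Finset.sum_nonneg fun k _ => (hv k).le
  exact binExpMin_le_Zstoch hv i (hp ▸ div_nonneg (hv i).le (by linarith)) T x hp.le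
end

section
/- Let T be a random variable with values in the nonnegative integers having the IFR property and finite mean μ_T. Let a ∈ ℕ with a < μ_T, and let p ∈ (0,1) satisfy (μ_T − a)·p ≤ 1. Then E_T[ (1 − (1−p)^{T−a})·1{T > a} ] ≥ (1/e)·p·(μ_T − a). -/
/-- Tail probability `P(T ≥ k)` of a distribution on `ℕ` given by the pmf `q`. -/
noncomputable def tailP (q : ℕ → ℝ) (k : ℕ) : ℝ := ∑' j : ℕ, q (k + j)

/-- Increasing failure rate property: the hazard rate `k ↦ q k / P(T ≥ k)` is
nondecreasing (stated in cross-multiplied form). -/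
def IFR (q : ℕ → ℝ) : Prop := ∀ k : ℕ, q k * tailP q (k + 1) ≤ q (k + 1) * tailP q k

open Finset

lemma tailP_eq_add {q : ℕ → ℝ} (hq : Summable q) (k : ℕ) :
    tailP q k = q k + tailP q (k + 1) := by
  have h : Summable fun j => q (k + j) := by
    simpa [add_comm] using (summable_nat_add_iff k).2 hq
  unfold tailP
  rw [h.tsum_eq_zero_add]
  simp [add_assoc, add_comm 1]

lemma tailP_nonneg {q : ℕ → ℝ} (hq0 : ∀ k, 0 ≤ q k) (k : ℕ) : 0 ≤ tailP q k :=
  tsum_nonneg fun _ => hq0 _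

lemma tailP_antitone {q : ℕ → ℝ} (hq0 : ∀ k, 0 ≤ q k) (hq : Summable q) :
    Antitone (tailP q) :=
  antitone_nat_of_succ_le fun k => by linarith [tailP_eq_add hq k, hq0 k]

lemma tailP_one_sub_le {g : ℕ → ℝ} (hg : Summable g) (hg1 : ∀ k, g k ≤ 1) (k : ℕ) :
    tailP g 1 - k ≤ tailP g (k + 1) := by
  induction k with
  | zero => simp
  | succ k ih =>
    have := tailP_eq_add hg (k + 1)
    have := hg1 (k + 1)
    push_cast
    linarith

/-- The ratios `tailP q (k + 1) / tailP q k` of an IFR distribution are nonincreasing. -/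
lemma IFR.tailP_mul_le {q : ℕ → ℝ} (hI : IFR q) (hq0 : ∀ k, 0 ≤ q k) (hq : Summable q)
    (k l : ℕ) (hkl : k ≤ l) :
    tailP q k * tailP q (l + 1) ≤ tailP q (k + 1) * tailP q l := by
  induction l, hkl using Nat.le_induction with
  | base => rw [mul_comm]
  | succ l _ ih =>
    have hanti := tailP_antitone hq0 hq
    rcases (tailP_nonneg hq0 (l + 1)).eq_or_lt with h0 | hpos
    · have h1 : tailP q (l + 1 + 1) = 0 :=
        le_antisymm (h0 ▸ hanti (Nat.le_succ _)) (tailP_nonneg hq0 _)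
      rw [h1, ← h0]
      simp
    · have hl : 0 < tailP q l := hpos.trans_le (hanti (Nat.le_succ _))
      have hlc : tailP q l * tailP q (l + 1 + 1) ≤ tailP q (l + 1) * tailP q (l + 1) := by
        have := hI l
        have e1 := tailP_eq_add hq l
        have e2 := tailP_eq_add hq (l + 1)
        rw [show q l = tailP q l - tailP q (l + 1) by linarith,
          show q (l + 1) = tailP q (l + 1) - tailP q (l + 1 + 1) by linarith] at this
        linarith
      refine le_of_mul_le_mul_left ?_ hl
      have h1 := mul_le_mul_of_nonneg_left hlc (tailP_nonneg hq0 k)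
      have h2 := mul_le_mul_of_nonneg_right ih hpos.le
      linarith

lemma IFR.tailP_mul_tailP_tailP_le {q : ℕ → ℝ} (hI : IFR q) (hq0 : ∀ k, 0 ≤ q k)
    (hq : Summable q) (ht : Summable (tailP q)) (k l : ℕ) (hkl : k ≤ l) :
    tailP q k * tailP (tailP q) (l + 1) ≤ tailP q (k + 1) * tailP (tailP q) l := by
  have hs (n : ℕ) : Summable fun j => tailP q (n + j) := by
    simpa [add_comm] using (summable_nat_add_iff n).2 ht
  rw [tailP.eq_1 (tailP q), tailP.eq_1 (tailP q), ← tsum_mul_left, ← tsum_mul_left]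
  refine Summable.tsum_le_tsum (fun j => ?_) ((hs _).mul_left _) ((hs _).mul_left _)
  rw [add_right_comm l 1 j]
  exact hI.tailP_mul_le hq0 hq k (l + j) (hkl.trans (Nat.le_add_right _ _))

lemma ifr_tailP {q : ℕ → ℝ} (hI : IFR q) (hq0 : ∀ k, 0 ≤ q k) (hq : Summable q)
    (ht : Summable (tailP q)) : IFR (tailP q) :=
  fun k => hI.tailP_mul_tailP_tailP_le hq0 hq ht k k le_rfl

/-- Summation by parts: `E[∑ i < T, w i] = ∑ i, w i * P(T ≥ i + 1)`. -/
lemma hasSum_mul_tailP {q w : ℕ → ℝ} (hq0 : ∀ k, 0 ≤ q k) (hq : Summable q)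
    (hw : ∀ i, 0 ≤ w i) (hs : Summable fun k => q k * ∑ i ∈ range k, w i) :
    HasSum (fun i => w i * tailP q (i + 1)) (∑' k, q k * ∑ i ∈ range k, w i) := by
  set f : ℕ × ℕ → ℝ := fun x => if x.2 < x.1 then q x.1 * w x.2 else 0 with hf
  have hrow (k : ℕ) : HasSum (fun i => f (k, i)) (q k * ∑ i ∈ range k, w i) := by
    rw [mul_sum]
    have : ∑ i ∈ range k, q k * w i = ∑ i ∈ range k, f (k, i) :=
      sum_congr rfl fun i hi => by simp [hf, mem_range.1 hi]
    rw [this]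
    exact hasSum_sum_of_ne_finset_zero fun i hi => by
      simp only [mem_range] at hi
      simp [hf, hi]
  have hf0 : 0 ≤ f := fun x => by
    simp only [hf]
    split_ifs
    · exact mul_nonneg (hq0 _) (hw _)
    · exact le_rfl
  have hsum : Summable f :=
    (summable_prod_of_nonneg hf0).2
      ⟨fun k => (hrow k).summable, by simpa only [(hrow _).tsum_eq] using hs⟩
  have hcol (i : ℕ) : HasSum (fun k => f (k, i)) (w i * tailP q (i + 1)) := by
    have h : HasSum (fun j => q (i + 1 + j)) (tailP q (i + 1)) :=
      Summable.hasSum (by simpa [add_comm, add_left_comm] using (summable_nat_add_iff (i + 1)).2 hq)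
    rw [← hasSum_nat_add_iff' (i + 1)]
    have h0 : ∑ k ∈ range (i + 1), f (k, i) = 0 :=
      sum_eq_zero fun k hk => by
        have := mem_range.1 hk
        exact if_neg (by omega)
    rw [h0, sub_zero]
    refine (h.mul_left (w i)).congr_fun fun j => ?_
    simp only [hf]
    rw [if_pos (by omega), mul_comm, add_comm j]
  have htot : HasSum f (∑' k, q k * ∑ i ∈ range k, w i) := by
    have h := hsum.hasSum
    rwa [← (h.prod_fiberwise hrow).tsum_eq] at h
  exact ((Equiv.prodComm ℕ ℕ).hasSum_iff.2 htot).prod_fiberwise hcol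

/-- For an IFR sequence, discounted sums dominate those of the geometric sequence with the
same first term and the same total. -/
lemma IFR.le_tsum_pow_mul {g : ℕ → ℝ} (hI : IFR g) (hg0 : ∀ k, 0 ≤ g k) (hg : Summable g)
    (n : ℕ) (hV : 0 < tailP g n) {θ ρ : ℝ} (hθ0 : 0 ≤ θ) (hθ1 : θ < 1)
    (hρ : ρ * tailP g n = tailP g (n + 1)) (hρ0 : 0 ≤ ρ) (hρ1 : ρ ≤ 1) :
    g n ≤ (∑' j, θ ^ j * g (n + j)) * (1 - ρ * θ) := by
  have hstep (j : ℕ) : tailP g (n + j + 1) ≤ ρ * tailP g (n + j) := by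
    refine le_of_mul_le_mul_left ?_ hV
    have := hI.tailP_mul_le hg0 hg n (n + j) (Nat.le_add_right _ _)
    rw [← hρ] at this
    linarith
  have hbound (j : ℕ) : tailP g (n + j) ≤ ρ ^ j * tailP g n := by
    induction j with
    | zero => simp
    | succ j ih =>
      calc tailP g (n + (j + 1)) ≤ ρ * tailP g (n + j) := hstep j
        _ ≤ ρ * (ρ ^ j * tailP g n) := mul_le_mul_of_nonneg_left ih hρ0
        _ = _ := by ring
  have hρθ0 : 0 ≤ ρ * θ := mul_nonneg hρ0 hθ0
  have hρθ : ρ * θ < 1 := by nlinarith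
  have hgeo := (hasSum_geometric_of_lt_one hρθ0 hρθ).mul_left (ρ * tailP g n)
  have hle (j : ℕ) : θ ^ j * tailP g (n + j + 1) ≤ ρ * tailP g n * (ρ * θ) ^ j := by
    have := mul_le_mul_of_nonneg_left (hbound (j + 1)) (pow_nonneg hθ0 j)
    rw [← add_assoc] at this
    refine this.trans_eq ?_
    rw [mul_pow]
    ring
  have hA : Summable fun j => θ ^ j * tailP g (n + j + 1) :=
    Summable.of_nonneg_of_le
      (fun j => mul_nonneg (pow_nonneg hθ0 _) (tailP_nonneg hg0 _)) hle hgeo.summable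
  set A := ∑' j, θ ^ j * tailP g (n + j + 1)
  have hAle : A ≤ ρ * tailP g n * (1 - ρ * θ)⁻¹ := hasSum_le hle hA.hasSum hgeo
  have hB : HasSum (fun j => θ ^ j * tailP g (n + j)) (θ * A + tailP g n) := by
    rw [← hasSum_nat_add_iff' 1, sum_range_one, pow_zero, one_mul, add_zero, add_sub_cancel_right]
    refine (hA.hasSum.mul_left θ).congr_fun fun j => ?_
    rw [← add_assoc, pow_succ]
    ring
  have hW : ∑' j, θ ^ j * g (n + j) = θ * A + tailP g n - A := by
    refine ((hB.sub hA.hasSum).congr_fun ?_).tsum_eq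
    intro j
    rw [tailP_eq_add hg (n + j)]
    ring
  rw [hW]
  have hpos : 0 < 1 - ρ * θ := by linarith
  have hAmul : A * (1 - ρ * θ) ≤ ρ * tailP g n := by
    have := mul_le_mul_of_nonneg_right hAle hpos.le
    rwa [mul_assoc (ρ * tailP g n), inv_mul_cancel₀ hpos.ne', mul_one] at this
  have hgn : g n = (1 - ρ) * tailP g n := by
    linarith [tailP_eq_add hg n]
  rw [hgn]
  nlinarith [mul_le_mul_of_nonneg_left hAmul (sub_nonneg.2 hθ1.le)]

lemma one_sub_add_le_exp_mul_pow (n : ℕ) {ρ : ℝ} (hρ : 0 ≤ ρ) (hρ1 : ρ ≤ 1) :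
    1 - n + (n + 1) * ρ ≤ Real.exp 1 * ρ ^ n := by
  rcases n.eq_zero_or_pos with rfl | hn
  · have := Real.add_one_le_exp (1 : ℝ)
    simp
    linarith
  have hn0 : (0 : ℝ) < n := Nat.cast_pos.2 hn
  have hx : 0 ≤ (n + 1) * ρ / n := by positivity
  have hB := one_add_mul_le_pow (a := (n + 1) * ρ / n - 1) (by linarith) n
  have he : ((1 + 1 / n : ℝ)) ^ n ≤ Real.exp 1 := by
    have h := pow_le_pow_left₀ (by positivity)
      ((add_comm (1 : ℝ) (1 / n)).trans_le (Real.add_one_le_exp (1 / n : ℝ))) n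
    rwa [← Real.exp_nat_mul, mul_one_div_cancel hn0.ne'] at h
  calc 1 - n + (n + 1) * ρ = 1 + n * ((n + 1) * ρ / n - 1) := by
        field_simp
        ring
    _ ≤ (1 + ((n + 1) * ρ / n - 1)) ^ n := hB
    _ = (1 + 1 / n) ^ n * ρ ^ n := by
        rw [← mul_pow]
        congr 1
        field_simp
        ring
    _ ≤ _ := mul_le_mul_of_nonneg_right he (pow_nonneg hρ n)

lemma add_sub_mul_le_exp_mul (n : ℕ) {ρ t : ℝ} (hρ : 0 ≤ ρ) (ht : ρ ≤ t) (ht1 : t ≤ 1) :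
    t - n * (1 - ρ) + ρ ≤ Real.exp 1 * (t * ρ ^ n) := by
  have h1 := one_sub_add_le_exp_mul_pow n hρ (ht.trans ht1)
  have h2 := one_sub_add_le_exp_mul_pow (n + 1) hρ (ht.trans ht1)
  push_cast at h2
  rw [pow_succ] at h2
  rcases ht1.eq_or_lt with rfl | hlt
  · linarith
  have hlt' : ρ < 1 := ht.trans_lt hlt
  refine le_of_mul_le_mul_left ?_ (sub_pos.2 hlt')
  have h3 := mul_le_mul_of_nonneg_left h1 (sub_nonneg.2 ht)
  have h4 := mul_le_mul_of_nonneg_left h2 (sub_nonneg.2 ht1)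
  linarith

lemma exists_pow_succ_le_le_pow {ρ s : ℝ} (hs : s ≤ 1) (a : ℕ) (ha : ρ ^ (a + 1) ≤ s) :
    ∃ n ≤ a, ρ ^ (n + 1) ≤ s ∧ s ≤ ρ ^ n := by
  induction a with
  | zero => exact ⟨0, le_rfl, ha, by simpa using hs⟩
  | succ a ih =>
    by_cases h : ρ ^ (a + 1) ≤ s
    · obtain ⟨n, hn, h'⟩ := ih h
      exact ⟨n, hn.trans (Nat.le_succ a), h'⟩
    · exact ⟨a + 1, le_rfl, ha, (not_le.1 h).le⟩

/-- An IFR variable `T` with mean `μ > a` has `P(T > a)` bounded below in terms of the ratio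
`ρ` of consecutive integrated tails at `a + 1`. -/
lemma IFR.le_exp_mul_tailP {q : ℕ → ℝ} (hI : IFR q) (hq0 : ∀ k, 0 ≤ q k) (hq : Summable q)
    (ht : Summable (tailP q)) (h1 : tailP q 0 = 1) {a : ℕ}
    (ha : (a : ℝ) < tailP (tailP q) 1) {ρ : ℝ} (hρ0 : 0 ≤ ρ) (hρ1 : ρ ≤ 1)
    (hρ : ρ * tailP (tailP q) (a + 1) = tailP (tailP q) (a + 2)) :
    (tailP (tailP q) 1 - a) * (1 - ρ) + ρ ≤
      Real.exp 1 * tailP q (a + 1) := by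
  set t := tailP q
  set V := tailP t
  set m := V 1 - a
  have ht0 : ∀ k, 0 ≤ t k := tailP_nonneg hq0
  have ht1 (k : ℕ) : t k ≤ 1 := h1 ▸ tailP_antitone hq0 hq (Nat.zero_le k)
  have hVs : ∀ k, V k = t k + V (k + 1) := tailP_eq_add ht
  have hVlow : ∀ k : ℕ, V 1 - k ≤ V (k + 1) := tailP_one_sub_le ht ht1
  have hVpos : 0 < V (a + 1) := by linarith [hVlow a]
  have hstep (k : ℕ) (hk : k ≤ a) : ρ * t k ≤ t (k + 1) := by
    have h := hI.tailP_mul_tailP_tailP_le hq0 hq ht k (a + 1) (by omega)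
    refine le_of_mul_le_mul_right ?_ hVpos
    calc ρ * t k * V (a + 1) = t k * V (a + 2) := by rw [← hρ]; ring
      _ ≤ _ := h
  have hpow (n k : ℕ) (hnk : k + n = a + 1) : ρ ^ n * t k ≤ t (a + 1) := by
    induction n generalizing k with
    | zero => simp [show k = a + 1 by omega]
    | succ n ih =>
      calc ρ ^ (n + 1) * t k = ρ ^ n * (ρ * t k) := by ring
        _ ≤ ρ ^ n * t (k + 1) :=
          mul_le_mul_of_nonneg_left (hstep k (by omega)) (pow_nonneg hρ0 n)
        _ ≤ _ := ih (k + 1) (by omega)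
  have hsV : t (a + 1) = (1 - ρ) * V (a + 1) := by
    have := hVs (a + 1)
    linarith
  have hVup (n k : ℕ) (hnk : k + n = a + 1) : ρ ^ n * ((1 - ρ) * V k) ≤ t (a + 1) := by
    induction n generalizing k with
    | zero => simp [show k = a + 1 by omega, hsV]
    | succ n ih =>
      have e1 := mul_le_mul_of_nonneg_left (ih (k + 1) (by omega)) hρ0
      have e2 := mul_le_mul_of_nonneg_left (hpow (n + 1) k hnk) (sub_nonneg.2 hρ1)
      rw [hVs k]
      rw [pow_succ] at e2 ⊢
      linarith
  have hs_low : ρ ^ (a + 1) ≤ t (a + 1) := by simpa [h1] using hpow (a + 1) 0 (by omega)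
  obtain ⟨n, hna, hn1, hn2⟩ := exists_pow_succ_le_le_pow (ht1 (a + 1)) a hs_low
  have hspos : 0 < t (a + 1) := by
    rcases hρ1.eq_or_lt with rfl | h
    · simpa using one_pos.trans_le (by simpa using hs_low)
    · rw [hsV]
      exact mul_pos (sub_pos.2 h) hVpos
  have hρn : 0 < ρ ^ n := hspos.trans_le hn2
  have hVn := hVup n (a - n + 1) (by omega)
  have hVl := hVlow (a - n)
  rw [Nat.cast_sub hna] at hVl
  have hτ : t (a + 1) = t (a + 1) / ρ ^ n * ρ ^ n := (div_mul_cancel₀ _ hρn.ne').symm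
  have hfin := add_sub_mul_le_exp_mul n hρ0
    ((le_div_iff₀ hρn).2 (by rwa [← pow_succ'])) ((div_le_one hρn).2 hn2)
  rw [← hτ] at hfin
  have hVd : (1 - ρ) * V (a - n + 1) ≤ t (a + 1) / ρ ^ n :=
    (le_div_iff₀ hρn).2 (by rwa [mul_comm])
  have := mul_le_mul_of_nonneg_left hVl (sub_nonneg.2 hρ1)
  linarith

lemma sum_range_ite_geometric (p : ℝ) (a k : ℕ) :
    ∑ i ∈ range k, (if a ≤ i then p * (1 - p) ^ (i - a) else 0) =
      if a < k then 1 - (1 - p) ^ (k - a) else 0 := by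
  induction k with
  | zero => simp
  | succ k ih =>
    rw [sum_range_succ, ih]
    rcases lt_trichotomy a k with h | rfl | h
    · rw [if_pos h, if_pos h.le, if_pos (by omega), Nat.succ_sub h.le, pow_succ]
      ring
    · simp
    · rw [if_neg (by omega), if_neg (by omega), if_neg (by omega), add_zero]

theorem stmt15 (q : ℕ → ℝ) (hq0 : ∀ k, 0 ≤ q k) (hqs : Summable q)
    (hq1 : ∑' k, q k = 1) (hIFR : IFR q)
    (μ : ℝ) (hms : Summable (fun k : ℕ => (k : ℝ) * q k))
    (hμ : μ = ∑' k : ℕ, (k : ℝ) * q k)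
    (a : ℕ) (ha : (a : ℝ) < μ)
    (p : ℝ) (hp0 : 0 < p) (hp1 : p < 1)
    (hcap : (μ - a) * p ≤ 1) :
    (1 / Real.exp 1) * (p * (μ - a)) ≤
      ∑' k : ℕ, q k * (if a < k then 1 - (1 - p) ^ (k - a) else 0) := by
  have hμs : Summable fun k => q k * ∑ i ∈ range k, (1 : ℝ) := by
    simpa [mul_comm] using hms
  have hsum1 := hasSum_mul_tailP hq0 hqs (fun _ => zero_le_one) hμs
  simp only [one_mul] at hsum1
  have ht : Summable (tailP q) := (summable_nat_add_iff 1).1 hsum1.summable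
  have hV1 : tailP (tailP q) 1 = μ := by
    rw [hμ, tailP.eq_1 (tailP q)]
    simpa [add_comm, mul_comm] using hsum1.tsum_eq
  have ht0 : ∀ k, 0 ≤ tailP q k := tailP_nonneg hq0
  have h1 : tailP q 0 = 1 := by simpa [tailP] using hq1
  set w : ℕ → ℝ := fun i => if a ≤ i then p * (1 - p) ^ (i - a) else 0 with hw
  have hθ0 : 0 ≤ 1 - p := by linarith
  have hw0 (i : ℕ) : 0 ≤ w i := by
    simp only [hw]
    split_ifs <;> positivity
  have hw1 (i : ℕ) : w i ≤ 1 := by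
    simp only [hw]
    split_ifs
    · exact mul_le_one₀ hp1.le (by positivity) (pow_le_one₀ hθ0 (by linarith))
    · exact zero_le_one
  have hws : Summable fun k => q k * ∑ i ∈ range k, w i :=
    Summable.of_nonneg_of_le (fun k => mul_nonneg (hq0 k) (sum_nonneg fun i _ => hw0 i))
      (fun k => mul_le_mul_of_nonneg_left (sum_le_sum fun i _ => hw1 i) (hq0 k)) hμs
  have hsumw := hasSum_mul_tailP hq0 hqs hw0 hws
  simp only [hw, sum_range_ite_geometric] at hsumw
  rw [← hasSum_nat_add_iff' a, sum_eq_zero, sub_zero] at hsumw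
  swap
  · intro i hi
    rw [if_neg (not_le.2 (mem_range.1 hi)), zero_mul]
  rw [← hsumw.tsum_eq]
  have hW : ∑' j, (if a ≤ j + a then p * (1 - p) ^ (j + a - a) else 0) * tailP q (j + a + 1) =
      p * ∑' j, (1 - p) ^ j * tailP q (a + 1 + j) := by
    rw [← tsum_mul_left]
    refine tsum_congr fun j => ?_
    rw [if_pos (Nat.le_add_left _ _), Nat.add_sub_cancel, show j + a + 1 = a + 1 + j by omega,
      mul_assoc]
  rw [hW]
  have hVpos : 0 < tailP (tailP q) (a + 1) := by
    have := tailP_one_sub_le ht (fun k => h1 ▸ tailP_antitone hq0 hqs (Nat.zero_le k)) a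
    linarith
  obtain ⟨ρ, hρ⟩ : ∃ ρ, ρ * tailP (tailP q) (a + 1) = tailP (tailP q) (a + 2) :=
    ⟨_, div_mul_cancel₀ _ hVpos.ne'⟩
  have hρ0 : 0 ≤ ρ := nonneg_of_mul_nonneg_left (hρ ▸ tailP_nonneg ht0 _) hVpos
  have hρ1 : ρ ≤ 1 := by
    refine le_of_mul_le_mul_right ?_ hVpos
    rw [hρ, one_mul]
    exact tailP_antitone ht0 ht (Nat.le_succ _)
  have hlow := (ifr_tailP hIFR hq0 hqs ht).le_tsum_pow_mul ht0 ht (a + 1) hVpos hθ0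
    (by linarith : 1 - p < 1) hρ hρ0 hρ1
  have hs := hIFR.le_exp_mul_tailP hq0 hqs ht h1 (hV1.symm ▸ ha) hρ0 hρ1 hρ
  rw [hV1] at hs
  set W := ∑' j, (1 - p) ^ j * tailP q (a + 1 + j)
  have hD : 0 < 1 - ρ * (1 - p) := by nlinarith
  have hkey : μ - a ≤ Real.exp 1 * W := by
    refine le_of_mul_le_mul_right ?_ hD
    have e1 := mul_le_mul_of_nonneg_left hlow (Real.exp_pos 1).le
    have e2 := mul_le_mul_of_nonneg_left hcap hρ0
    linarith
  rw [one_div, inv_mul_le_iff₀ (Real.exp_pos 1)]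
  linarith [mul_le_mul_of_nonneg_left hkey hp0.le]
end

section
/- For every integer x ≥ 1, every T ∈ ℕ, and every p ∈ (0,1), E[min(Bin(T,p), x)] ≥ x·E[min(Bin(T, p/x), 1)] = x·(1 − (1 − p/x)^T). -/
theorem sum_one_sub_pow_mul_binomial (T : ℕ) (p r : ℝ) :
    ∑ k ∈ Finset.range (T + 1), (1 - r ^ k) * ((T.choose k : ℝ) * p ^ k * (1 - p) ^ (T - k)) =
      1 - (1 - p * (1 - r)) ^ T := by
  have h₁ := add_pow p (1 - p) T
  have h₂ := add_pow (p * r) (1 - p) T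
  rw [add_sub_cancel, one_pow] at h₁
  rw [show 1 - p * (1 - r) = p * r + (1 - p) by ring, h₂]
  refine Eq.trans ?_ (congrArg (· - _) h₁.symm)
  rw [← Finset.sum_sub_distrib]
  refine Finset.sum_congr rfl fun k _ ↦ ?_
  rw [mul_pow]
  ring

theorem binExpMin_one (T : ℕ) (p : ℝ) : binExpMin T p 1 = 1 - (1 - p) ^ T := by
  have h := sum_one_sub_pow_mul_binomial T p 0
  rw [sub_zero, mul_one] at h
  rw [← h, binExpMin]
  refine Finset.sum_congr rfl fun k _ ↦ ?_
  rcases k with _ | k <;> simp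

theorem mul_one_sub_pow_le_min (x : ℕ) (hx : 1 ≤ x) (k : ℕ) :
    (x : ℝ) * (1 - (1 - 1 / (x : ℝ)) ^ k) ≤ min (k : ℝ) x := by
  have hx' : (1 : ℝ) ≤ x := by exact_mod_cast hx
  have hx0 : (0 : ℝ) < x := by linarith
  have hinv : 1 / (x : ℝ) ≤ 1 := (div_le_one hx0).2 hx'
  have hbern := one_add_mul_le_pow (a := -(1 / (x : ℝ))) (by linarith) k
  rw [← sub_eq_add_neg] at hbern
  have hpow : 0 ≤ (1 - 1 / (x : ℝ)) ^ k := pow_nonneg (by linarith) k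
  refine le_min ?_ (by nlinarith)
  calc (x : ℝ) * (1 - (1 - 1 / (x : ℝ)) ^ k) ≤ x * (k * (1 / (x : ℝ))) := by
        gcongr
        linarith
    _ = k := by field_simp

theorem stmt16 (x : ℕ) (hx : 1 ≤ x) (T : ℕ) (p : ℝ) (hp0 : 0 < p) (hp1 : p < 1) :
    (x : ℝ) * binExpMin T (p / x) 1 ≤ binExpMin T p (x : ℝ) ∧
    (x : ℝ) * binExpMin T (p / x) 1 = (x : ℝ) * (1 - (1 - p / x) ^ T) := by
  refine ⟨?_, by rw [binExpMin_one]⟩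
  have h := sum_one_sub_pow_mul_binomial T p (1 - 1 / (x : ℝ))
  rw [sub_sub_cancel, mul_one_div] at h
  rw [binExpMin_one, ← h, Finset.mul_sum, binExpMin]
  refine Finset.sum_le_sum fun k _ ↦ ?_
  have hq : 0 ≤ 1 - p := by linarith
  rw [← mul_assoc]
  exact mul_le_mul_of_nonneg_right (mul_one_sub_pow_le_min x hx k) (by positivity)
end

section
/- Let c ∈ ℤ_{≥0}^n and let T be a random variable with values in the nonnegative integers having finite mean μ_T. Then the expected total revenue of the stochastic consumption process is bounded above by the CDLP value at the mean horizon: E_T[ Σ_{i=1}^n r_i Z_i(c,T) ] ≤ f_LP(c, μ_T). -/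
open Finset

/-- Feasibility for the sales-based CDLP with inventory `c` and horizon `T`:
`y ≥ 0`, `∑ i yᵢ + y₀ = T`, `yᵢ ≤ cᵢ`, and `yᵢ ≤ vᵢ y₀`. -/
def feasibleLP {n : ℕ} (v c : Fin n → ℝ) (T : ℝ) (y0 : ℝ) (y : Fin n → ℝ) : Prop :=
  0 ≤ y0 ∧ (∀ i, 0 ≤ y i) ∧ (∑ i, y i) + y0 = T ∧ (∀ i, y i ≤ c i) ∧ ∀ i, y i ≤ v i * y0

/-- Sales-based CDLP value `f_LP(c,T)` (the feasible region is a nonempty compact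
polytope, so this supremum is attained). -/
noncomputable def fLP {n : ℕ} (r v c : Fin n → ℝ) (T : ℝ) : ℝ :=
  sSup {s : ℝ | ∃ y0 : ℝ, ∃ y : Fin n → ℝ, feasibleLP v c T y0 y ∧ s = ∑ i, r i * y i}

/-- Expectation of `f` at the inventory left after one customer faced inventory `x`. -/
noncomputable def expectNext {n : ℕ} (v : Fin n → ℝ) (f : (Fin n → ℕ) → ℝ)
    (x : Fin n → ℕ) : ℝ :=
  (∑ j ∈ Finset.univ.filter (fun k => 1 ≤ x k),
      v j / (1 + ∑ k ∈ Finset.univ.filter (fun k => 1 ≤ x k), v k) *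
        f (fun k => if k = j then x k - 1 else x k)) +
    (1 / (1 + ∑ k ∈ Finset.univ.filter (fun k => 1 ≤ x k), v k)) * f x

lemma one_add_sum_available_pos {n : ℕ} {v : Fin n → ℝ} (hv : ∀ i, 0 < v i) (x : Fin n → ℕ) :
    0 < 1 + ∑ k ∈ Finset.univ.filter (fun k => 1 ≤ x k), v k := by
  have : 0 ≤ ∑ k ∈ Finset.univ.filter (fun k => 1 ≤ x k), v k :=
    Finset.sum_nonneg fun i _ => (hv i).le
  linarith

lemma choice_prob_sum {n : ℕ} {v : Fin n → ℝ} (hv : ∀ i, 0 < v i) (x : Fin n → ℕ) :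
    (∑ j ∈ Finset.univ.filter (fun k => 1 ≤ x k),
      v j / (1 + ∑ k ∈ Finset.univ.filter (fun k => 1 ≤ x k), v k)) +
    1 / (1 + ∑ k ∈ Finset.univ.filter (fun k => 1 ≤ x k), v k) = 1 := by
  rw [← Finset.sum_div, ← add_div, add_comm]
  exact div_self (one_add_sum_available_pos hv x).ne'

lemma expectNext_mono {n : ℕ} {v : Fin n → ℝ} (hv : ∀ i, 0 < v i)
    {f g : (Fin n → ℕ) → ℝ} (hfg : ∀ x, f x ≤ g x) (x : Fin n → ℕ) :
    expectNext v f x ≤ expectNext v g x := by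
  have hD := one_add_sum_available_pos hv x
  unfold expectNext
  refine add_le_add (Finset.sum_le_sum fun j _ => ?_) ?_
  · exact mul_le_mul_of_nonneg_left (hfg _) (div_nonneg (hv j).le hD.le)
  · exact mul_le_mul_of_nonneg_left (hfg _) (by positivity)

lemma expectNext_const {n : ℕ} {v : Fin n → ℝ} (hv : ∀ i, 0 < v i) (a : ℝ) (x : Fin n → ℕ) :
    expectNext v (fun _ => a) x = a := by
  unfold expectNext
  rw [← Finset.sum_mul, ← add_mul, choice_prob_sum hv x, one_mul]

lemma expectNext_sub {n : ℕ} (v : Fin n → ℝ) (f g : (Fin n → ℕ) → ℝ) (x : Fin n → ℕ) :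
    expectNext v (fun z => f z - g z) x = expectNext v f x - expectNext v g x := by
  simp only [expectNext, mul_sub, Finset.sum_sub_distrib]
  ring

lemma expectNext_mul_left {n : ℕ} (v : Fin n → ℝ) (a : ℝ) (f : (Fin n → ℕ) → ℝ)
    (x : Fin n → ℕ) :
    expectNext v (fun z => a * f z) x = a * expectNext v f x := by
  simp only [expectNext, mul_left_comm _ a, ← Finset.mul_sum, mul_add]

lemma expectNext_sum {n : ℕ} (v : Fin n → ℝ) (f : Fin n → (Fin n → ℕ) → ℝ) (x : Fin n → ℕ) :
    expectNext v (fun z => ∑ i, f i z) x = ∑ i, expectNext v (f i) x := by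
  simp only [expectNext, Finset.mul_sum, Finset.sum_add_distrib]
  rw [Finset.sum_comm]

lemma Zstoch_succ {n : ℕ} (v : Fin n → ℝ) (i : Fin n) (T : ℕ) (x : Fin n → ℕ) :
    Zstoch v i (T + 1) x = expectNext v (Zstoch v i T) x +
      if 1 ≤ x i then v i / (1 + ∑ k ∈ Finset.univ.filter (fun k => 1 ≤ x k), v k) else 0 := by
  simp only [Zstoch, expectNext, mul_add, Finset.sum_add_distrib, mul_ite, mul_one, mul_zero,
    Finset.sum_ite_eq', Finset.mem_filter, Finset.mem_univ, true_and]
  ring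

lemma Zstoch_le_inventory {n : ℕ} {v : Fin n → ℝ} (hv : ∀ i, 0 < v i) (i : Fin n) (T : ℕ)
    (x : Fin n → ℕ) : Zstoch v i T x ≤ x i := by
  induction T generalizing x with
  | zero => simp [Zstoch]
  | succ T ih =>
    have hD := one_add_sum_available_pos hv x
    calc Zstoch v i (T + 1) x ≤ expectNext v (fun _ => (x i : ℝ)) x := by
          unfold Zstoch expectNext
          refine add_le_add (Finset.sum_le_sum fun j hj => ?_) ?_
          · refine mul_le_mul_of_nonneg_left ?_ (div_nonneg (hv j).le hD.le)
            have hj1 : 1 ≤ x j := (Finset.mem_filter.1 hj).2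
            have h := ih (fun k => if k = j then x k - 1 else x k)
            by_cases hji : j = i
            · subst hji
              simp only [if_true] at h ⊢
              rw [Nat.cast_sub hj1] at h
              push_cast at h
              linarith
            · simp only [if_neg hji, if_neg (Ne.symm hji)] at h ⊢
              linarith
          · exact mul_le_mul_of_nonneg_left (ih x) (by positivity)
      _ = x i := expectNext_const hv _ x

/-- The expected number of customers who buy nothing, `T - ∑ k, Z_k(x,T)`, gains
`φ(0, N(x))` from the first customer. -/
lemma expected_no_purchase_succ {n : ℕ} {v : Fin n → ℝ} (hv : ∀ i, 0 < v i) (T : ℕ)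
    (x : Fin n → ℕ) :
    ((T + 1 : ℕ) : ℝ) - ∑ k, Zstoch v k (T + 1) x =
      expectNext v (fun z => (T : ℝ) - ∑ k, Zstoch v k T z) x +
        1 / (1 + ∑ k ∈ Finset.univ.filter (fun k => 1 ≤ x k), v k) := by
  have h := choice_prob_sum hv x
  simp only [Zstoch_succ, Finset.sum_add_distrib, ← Finset.sum_filter]
  rw [expectNext_sub, expectNext_const hv, expectNext_sum]
  push_cast
  linarith

lemma Zstoch_sum_le {n : ℕ} {v : Fin n → ℝ} (hv : ∀ i, 0 < v i) (T : ℕ)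
    (x : Fin n → ℕ) : ∑ k, Zstoch v k T x ≤ T := by
  induction T generalizing x with
  | zero => simp [Zstoch]
  | succ T ih =>
    have h := expectNext_mono hv (fun z => sub_nonneg.2 (ih z)) x
    rw [expectNext_const hv] at h
    have hD := one_add_sum_available_pos hv x
    have hD' : 0 ≤ 1 / (1 + ∑ k ∈ Finset.univ.filter (fun k => 1 ≤ x k), v k) := by positivity
    have := expected_no_purchase_succ hv T x
    linarith

lemma Zstoch_le_mul_no_purchase {n : ℕ} {v : Fin n → ℝ} (hv : ∀ i, 0 < v i) (i : Fin n) (T : ℕ)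
    (x : Fin n → ℕ) : Zstoch v i T x ≤ v i * ((T : ℝ) - ∑ k, Zstoch v k T x) := by
  induction T generalizing x with
  | zero => simp [Zstoch]
  | succ T ih =>
    rw [expected_no_purchase_succ hv, Zstoch_succ, mul_add, ← expectNext_mul_left, mul_one_div]
    refine add_le_add (expectNext_mono hv ih x) ?_
    split_ifs
    · exact le_rfl
    · exact div_nonneg (hv i).le (one_add_sum_available_pos hv x).le

lemma le_fLP {n : ℕ} {r v c : Fin n → ℝ} (hr0 : ∀ i, 0 ≤ r i) {T y0 : ℝ} {y : Fin n → ℝ}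
    (h : feasibleLP v c T y0 y) : ∑ i, r i * y i ≤ fLP r v c T := by
  refine le_csSup ⟨∑ i, r i * c i, ?_⟩ ⟨y0, y, h, rfl⟩
  rintro s ⟨z0, z, hz, rfl⟩
  exact Finset.sum_le_sum fun i _ => mul_le_mul_of_nonneg_left (hz.2.2.2.1 i) (hr0 i)

theorem stmt17 {n : ℕ} (hn : 1 ≤ n) (r v : Fin n → ℝ)
    (hr : ∀ i j : Fin n, i ≤ j → r j ≤ r i) (hr0 : ∀ i, 0 ≤ r i)
    (hv : ∀ i, 0 < v i)
    (c : Fin n → ℕ)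
    (q : ℕ → ℝ) (hq0 : ∀ k, 0 ≤ q k) (hqs : Summable q)
    (hq1 : ∑' k, q k = 1)
    (μ : ℝ) (hms : Summable (fun k : ℕ => (k : ℝ) * q k))
    (hμ : μ = ∑' k : ℕ, (k : ℝ) * q k) :
    (∑' T : ℕ, q T * ∑ i, r i * Zstoch v i T c) ≤
      fLP r v (fun k => (c k : ℝ)) μ := by
  have hZle : ∀ i T, Zstoch v i T c ≤ T := fun i T =>
    (Finset.single_le_sum (f := fun k => Zstoch v k T c)
      (fun k _ => Zstoch_nonneg hv k T c) (Finset.mem_univ i)).trans (Zstoch_sum_le hv T c)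
  have hZs : ∀ i, Summable fun T : ℕ => q T * Zstoch v i T c := fun i =>
    Summable.of_nonneg_of_le (fun T => mul_nonneg (hq0 T) (Zstoch_nonneg hv i T c))
      (fun T => (mul_le_mul_of_nonneg_left (hZle i T) (hq0 T)).trans_eq (mul_comm _ _)) hms
  have hms' : Summable fun T : ℕ => q T * (T : ℝ) := by simpa only [mul_comm] using hms
  have hsum : Summable fun T : ℕ => q T * ∑ i, Zstoch v i T c := by
    simpa only [Finset.mul_sum] using summable_sum fun i _ => hZs i
  have h0s : Summable fun T : ℕ => q T * ((T : ℝ) - ∑ i, Zstoch v i T c) := by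
    simpa only [mul_sub] using hms'.sub hsum
  have hrev : (∑' T : ℕ, q T * ∑ i, r i * Zstoch v i T c) =
      ∑ i, r i * ∑' T : ℕ, q T * Zstoch v i T c := by
    simp only [Finset.mul_sum, mul_left_comm _ (r _), ← tsum_mul_left]
    exact Summable.tsum_finsetSum fun i _ => (hZs i).mul_left (r i)
  rw [hrev]
  refine le_fLP (y0 := ∑' T : ℕ, q T * ((T : ℝ) - ∑ i, Zstoch v i T c)) hr0
    ⟨?_, fun i => ?_, ?_, fun i => ?_, fun i => ?_⟩
  · exact tsum_nonneg fun T => mul_nonneg (hq0 T) (sub_nonneg.2 (Zstoch_sum_le hv T c))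
  · exact tsum_nonneg fun T => mul_nonneg (hq0 T) (Zstoch_nonneg hv i T c)
  · rw [← Summable.tsum_finsetSum fun i _ => hZs i]
    simp only [← Finset.mul_sum]
    rw [← hsum.tsum_add h0s, hμ]
    exact tsum_congr fun T => by ring
  · calc ∑' T : ℕ, q T * Zstoch v i T c ≤ ∑' T : ℕ, q T * (c i : ℝ) :=
          (hZs i).tsum_le_tsum
            (fun T => mul_le_mul_of_nonneg_left (Zstoch_le_inventory hv i T c) (hq0 T))
            (hqs.mul_right _)
      _ = c i := by rw [tsum_mul_right, hq1, one_mul]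
  · rw [← tsum_mul_left]
    refine (hZs i).tsum_le_tsum (fun T => ?_) (h0s.mul_left _)
    rw [mul_left_comm]
    exact mul_le_mul_of_nonneg_left (Zstoch_le_mul_no_purchase hv i T c) (hq0 T)
end
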